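/- Let F be a rooted finitely generated descriptive frame for K4.3. Then F is a frame for GL.3 if and only if every non-degenerate cluster of F is a limit cluster (equivalently, F contains no non-degenerate non-limit cluster). -/

import Mathlib

/-! ## Modal formulas -/

inductive MF : Type
  | var : ℕ → MF
  | top : MF
  | bot : MF
  | neg : MF → MF
  | and : MF → MF → MF
  | dia : MF → MF
deriving DecidableEq

namespace MF

def or (φ ψ : MF) : MF := .neg (.and (.neg φ) (.neg ψ))
def imp (φ ψ : MF) : MF := MF.or (.neg φ) ψ
def box (φ : MF) : MF := .neg (.dia (.neg φ))
def diaPlus (φ : MF) : MF := MF.or φ (.dia φ)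
def boxPlus (φ : MF) : MF := .and φ (box φ)

/-- the propositional variables occurring in a formula -/
def vars : MF → Finset ℕ
  | .var p => {p}
  | .top => ∅
  | .bot => ∅
  | .neg φ => vars φ
  | .and φ ψ => vars φ ∪ vars ψ
  | .dia φ => vars φ

/-- the signature of a formula -/
def sig (φ : MF) : Set ℕ := ↑(vars φ)

/-- subformulas -/
def subs : MF → Finset MF
  | .var p => {.var p}
  | .top => {.top}
  | .bot => {.bot}
  | .neg φ => insert (.neg φ) (subs φ)
  | .and φ ψ => insert (.and φ ψ) (subs φ ∪ subs ψ)
  | .dia φ => insert (.dia φ) (subs φ)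

/-- `|φ|`: the number of subformulas of `φ` together with their negations -/
def size (φ : MF) : ℕ := ((subs φ) ∪ (subs φ).image MF.neg).card

/-- uniform substitution -/
def substVar (s : ℕ → MF) : MF → MF
  | .var p => s p
  | .top => .top
  | .bot => .bot
  | .neg φ => .neg (substVar s φ)
  | .and φ ψ => .and (substVar s φ) (substVar s ψ)
  | .dia φ => .dia (substVar s φ)

end MF

/-- a Boolean evaluation of modal formulas (treating `◇`-formulas and variables as atoms) -/
def BoolEval (f : MF → Prop) : Prop :=
  f .top ∧ ¬ f .bot ∧ (∀ φ, f (.neg φ) ↔ ¬ f φ) ∧ (∀ φ ψ, f (.and φ ψ) ↔ (f φ ∧ f ψ))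

/-- Boolean tautologies in the modal language -/
def MF.Tautology (φ : MF) : Prop := ∀ f : MF → Prop, BoolEval f → f φ

/-- normal modal logics -/
structure IsNormalLogic (L : Set MF) : Prop where
  taut : ∀ φ, φ.Tautology → φ ∈ L
  axK : MF.imp (MF.box (MF.imp (.var 0) (.var 1)))
          (MF.imp (MF.box (.var 0)) (MF.box (.var 1))) ∈ L
  mp : ∀ φ ψ, φ ∈ L → MF.imp φ ψ ∈ L → ψ ∈ L
  subst : ∀ φ s, φ ∈ L → MF.substVar s φ ∈ L
  nec : ∀ φ, φ ∈ L → MF.box φ ∈ L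

/-- the smallest normal modal logic containing `Γ` -/
def NormClosure (Γ : Set MF) : Set MF :=
  {φ | ∀ L : Set MF, IsNormalLogic L → Γ ⊆ L → φ ∈ L}

def ax4 : MF := MF.imp (MF.box (.var 0)) (MF.box (MF.box (.var 0)))
def ax43 : MF := MF.or (MF.box (MF.imp (MF.boxPlus (.var 0)) (.var 1)))
                       (MF.box (MF.imp (MF.boxPlus (.var 1)) (.var 0)))
def axGL : MF := MF.imp (MF.box (MF.imp (MF.box (.var 0)) (.var 0))) (MF.box (.var 0))

def K4 : Set MF := NormClosure {ax4}
def K43 : Set MF := NormClosure {ax4, ax43}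
def GL3 : Set MF := NormClosure {ax4, ax43, axGL}

/-! ## General frames and models -/

/-- a (general) frame: a relation together with a collection of "internal" sets -/
structure KFrame (W : Type) where
  R : W → W → Prop
  P : Set (Set W)

namespace KFrame

variable {W : Type}

def dia (F : KFrame W) (X : Set W) : Set W := {x | ∃ y ∈ X, F.R x y}

/-- the conditions making `F` a general frame -/
def IsGeneral (F : KFrame W) : Prop :=
  Nonempty W ∧ ∅ ∈ F.P ∧ Set.univ ∈ F.P ∧
    (∀ X ∈ F.P, ∀ Y ∈ F.P, X ∩ Y ∈ F.P) ∧
    (∀ X ∈ F.P, Xᶜ ∈ F.P) ∧ (∀ X ∈ F.P, F.dia X ∈ F.P)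

/-- differentiated, tight and compact -/
def Descriptive (F : KFrame W) : Prop :=
  (∀ x y : W, (∀ X ∈ F.P, x ∈ X ↔ y ∈ X) → x = y) ∧
  (∀ x y : W, F.R x y ↔ ∀ X ∈ F.P, y ∈ X → x ∈ F.dia X) ∧
  (∀ 𝒳 : Set (Set W), 𝒳 ⊆ F.P →
    (∀ 𝒴 : Set (Set W), 𝒴 ⊆ 𝒳 → 𝒴.Finite → (⋂₀ 𝒴).Nonempty) → (⋂₀ 𝒳).Nonempty)

/-- `x` is a root of `F` (every point is reachable from `x` via the reflexive closure) -/
def Rooted (F : KFrame W) (x : W) : Prop := ∀ y : W, x = y ∨ F.R x y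

/-- the strict order on clusters: `C(x) <_R C(y)` -/
def clLT (F : KFrame W) (x y : W) : Prop := F.R x y ∧ ¬ F.R y x

/-- the cluster of a point -/
def cluster (F : KFrame W) (x : W) : Set W := insert x {y | F.R x y ∧ F.R y x}

def clLE (F : KFrame W) (x y : W) : Prop := y ∈ F.cluster x ∨ F.clLT x y

/-- the closed interval of clusters `[C(x), C(y)]` -/
def interval (F : KFrame W) (x y : W) : Set W := {z | F.clLE x z ∧ F.clLE z y}

/-- `C(x)` is the final cluster -/
def FinalCl (F : KFrame W) (x : W) : Prop := ∀ y, ¬ F.clLT x y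

/-- `C(y)` is an immediate successor of `C(x)` -/
def ImmSucc (F : KFrame W) (x y : W) : Prop :=
  F.clLT x y ∧ ¬ ∃ z, F.clLT x z ∧ F.clLT z y

/-- `C(x)` is a limit cluster -/
def LimitCl (F : KFrame W) (x : W) : Prop := ¬ F.FinalCl x ∧ ¬ ∃ y, F.ImmSucc x y

/-- `C(x)` is a degenerate cluster -/
def DegenerateCl (F : KFrame W) (x : W) : Prop := ¬ F.R x x

end KFrame

/-- the closure of a family of sets under `∩`, complement and `◇` -/
inductive genBy {W : Type} (R : W → W → Prop) (G : Set (Set W)) : Set W → Prop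
  | basic {X : Set W} : X ∈ G → genBy R G X
  | empty : genBy R G ∅
  | univ : genBy R G Set.univ
  | inter {X Y : Set W} : genBy R G X → genBy R G Y → genBy R G (X ∩ Y)
  | compl {X : Set W} : genBy R G X → genBy R G Xᶜ
  | dia {X : Set W} : genBy R G X → genBy R G {x | ∃ y ∈ X, R x y}

def KFrame.GeneratedBy {W : Type} (F : KFrame W) (G : Set (Set W)) : Prop :=
  F.P = {X | genBy F.R G X}

def KFrame.FinGenerated {W : Type} (F : KFrame W) : Prop :=
  ∃ G : Set (Set W), G.Finite ∧ F.GeneratedBy G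

def KFrame.NGenerated {W : Type} (F : KFrame W) (n : ℕ) : Prop :=
  ∃ G : Set (Set W), G.Finite ∧ G.ncard = n ∧ F.GeneratedBy G

/-- a model: a frame with a valuation -/
structure KModel (W : Type) where
  F : KFrame W
  v : ℕ → Set W

namespace KModel

variable {W : Type}

/-- the frame is a general frame and all values of the valuation are internal -/
def IsModel (M : KModel W) : Prop := M.F.IsGeneral ∧ ∀ p, M.v p ∈ M.F.P

/-- truth at a point -/
def sat (M : KModel W) : W → MF → Prop
  | x, .var p => x ∈ M.v p
  | _, .top => True
  | _, .bot => False
  | x, .neg φ => ¬ sat M x φ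
  | x, .and φ ψ => sat M x φ ∧ sat M x ψ
  | x, .dia φ => ∃ y, M.F.R x y ∧ sat M y φ

/-- a set is definable in `M` -/
def Definable (M : KModel W) (X : Set W) : Prop := ∃ φ : MF, X = {x | M.sat x φ}

/-- every internal set is definable in `M` -/
def MGenerated (M : KModel W) : Prop := ∀ X ∈ M.F.P, M.Definable X

/-- finitely `M`-generated -/
def FinMGenerated (M : KModel W) : Prop := M.MGenerated ∧ M.F.FinGenerated

/-- the σ-type of a point: all σ-formulas true at it -/
def stype (M : KModel W) (σ : Set ℕ) (x : W) : Set MF := {φ | φ.sig ⊆ σ ∧ M.sat x φ}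

/-- `x` is `Γ`-maximal in `M` -/
def MaxFor (M : KModel W) (Γ : Set MF) (x : W) : Prop :=
  (∀ γ ∈ Γ, M.sat x γ) ∧ ∀ y, M.F.R x y → (∀ γ ∈ Γ, M.sat y γ) → M.F.R y x

/-- the cluster `C(x)` is `μ`-maximal in `M` -/
def ClMuMax (M : KModel W) (μ : MF) (x : W) : Prop := ∃ z ∈ M.F.cluster x, M.MaxFor {μ} z

/-- the cluster `C(x)` is maximal in `M` -/
def ClMax (M : KModel W) (x : W) : Prop := ∃ μ : MF, M.ClMuMax μ x

/-- the cluster `C(x)` is σ-maximal in `M` -/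
def ClSigMax (M : KModel W) (σ : Set ℕ) (x : W) : Prop :=
  ∃ μ : MF, μ.sig ⊆ σ ∧ M.ClMuMax μ x

/-- the cluster `C(x)` is definable in `M` -/
def ClDefinable (M : KModel W) (x : W) : Prop := M.Definable (M.F.cluster x)

/-- `◇ t^σ_M(x) ⊆ t^σ_M(y)` -/
def diaSubset (M : KModel W) (σ : Set ℕ) (x y : W) : Prop :=
  ∀ φ ∈ M.stype σ x, MF.dia φ ∈ M.stype σ y

/-- the σ-block of a point -/
def sblockOf (M : KModel W) (σ : Set ℕ) (x : W) : Set W :=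
  {y | (M.diaSubset σ x x ∧ M.diaSubset σ y x ∧ M.diaSubset σ x y) ∨
       (¬ M.diaSubset σ x x ∧ y = x)}

/-- a σ-block in `M` -/
def IsSBlock (M : KModel W) (σ : Set ℕ) (b : Set W) : Prop := ∃ x, b = M.sblockOf σ x

/-- a degenerate σ-block in `M` -/
def DegenSBlock (M : KModel W) (σ : Set ℕ) (b : Set W) : Prop :=
  ∃ x, b = M.sblockOf σ x ∧ ¬ M.diaSubset σ x x

end KModel

/-- validity of a formula on a frame -/
def KFrame.Valid {W : Type} (F : KFrame W) (φ : MF) : Prop :=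
  ∀ v : ℕ → Set W, (∀ p, v p ∈ F.P) → ∀ x, (KModel.mk F v).sat x φ

/-- `F` is a frame for the logic `L` -/
def KFrame.IsFrameFor {W : Type} (F : KFrame W) (L : Set MF) : Prop :=
  ∀ φ ∈ L, F.Valid φ

/-! ## Bisimulations -/

def IsBisim {W₁ W₂ : Type} (σ : Set ℕ) (M₁ : KModel W₁) (M₂ : KModel W₂)
    (β : W₁ → W₂ → Prop) : Prop :=
  ∀ x₁ x₂, β x₁ x₂ →
    (∀ p ∈ σ, x₁ ∈ M₁.v p ↔ x₂ ∈ M₂.v p) ∧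
    (∀ y₁, M₁.F.R x₁ y₁ → ∃ y₂, M₂.F.R x₂ y₂ ∧ β y₁ y₂) ∧
    (∀ y₂, M₂.F.R x₂ y₂ → ∃ y₁, M₁.F.R x₁ y₁ ∧ β y₁ y₂)

def Bisimilar {W₁ W₂ : Type} (σ : Set ℕ) (M₁ : KModel W₁) (x₁ : W₁)
    (M₂ : KModel W₂) (x₂ : W₂) : Prop :=
  ∃ β, IsBisim σ M₁ M₂ β ∧ β x₁ x₂

/-- the two points satisfy the same variables of `σ` -/
def SigAgree {W₁ W₂ : Type} (σ : Set ℕ) (M₁ : KModel W₁) (x₁ : W₁)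
    (M₂ : KModel W₂) (x₂ : W₂) : Prop :=
  ∀ p ∈ σ, x₁ ∈ M₁.v p ↔ x₂ ∈ M₂.v p

/-- the two points have the same σ-type -/
def TypeEquiv {W₁ W₂ : Type} (σ : Set ℕ) (M₁ : KModel W₁) (x₁ : W₁)
    (M₂ : KModel W₂) (x₂ : W₂) : Prop :=
  ∀ φ : MF, φ.sig ⊆ σ → (M₁.sat x₁ φ ↔ M₂.sat x₂ φ)

/-! ## Interpolants -/

def IsInterpolant (L : Set MF) (φ₁ φ₂ ι : MF) : Prop :=
  ι.sig ⊆ φ₁.sig ∩ φ₂.sig ∧ MF.imp φ₁ ι ∈ L ∧ MF.imp ι φ₂ ∈ L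

def NoInterpolant (L : Set MF) (φ₁ φ₂ : MF) : Prop := ¬ ∃ ι, IsInterpolant L φ₁ φ₂ ι

def HasCIP (L : Set MF) : Prop :=
  ∀ φ₁ φ₂ : MF, MF.imp φ₁ φ₂ ∈ L → ∃ ι, IsInterpolant L φ₁ φ₂ ι

/-- `k(φ₁,φ₂) = 3 + 3·max(|φ₁|,|φ₂|)` -/
def kBound (φ₁ φ₂ : MF) : ℕ := 3 + 3 * max φ₁.size φ₂.size

/-- the conjunction of a finite list of formulas -/
def conjList : List MF → MF
  | [] => .top
  | φ :: l => .and φ (conjList l)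

/-! ## d-persistence and cofinal subframe logics -/

def DPersistent (L : Set MF) : Prop :=
  ∀ (W : Type) (F : KFrame W), F.IsGeneral → F.Descriptive → F.IsFrameFor L →
    KFrame.IsFrameFor ⟨F.R, (Set.univ : Set (Set W))⟩ L

def CofinalSet {W : Type} (F : KFrame W) (S : Set W) : Prop :=
  ∀ x ∈ S, ∀ y, F.R x y → y ∈ S ∨ ∃ z ∈ S, F.R y z

/-- the subframe of `F` with underlying set `S` and internal sets `Q` -/
def subframeOn {W : Type} (F : KFrame W) (S : Set W) (Q : Set (Set W)) : KFrame S :=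
  ⟨fun a b => F.R a.1 b.1, {T | ∃ X ∈ Q, T = (Subtype.val ⁻¹' X : Set S)}⟩

/-- the class of general frames of `L` is closed under cofinal subframes -/
def CofinalSubframeLogic (L : Set MF) : Prop :=
  ∀ (W : Type) (F : KFrame W) (S : Set W) (Q : Set (Set W)),
    F.IsGeneral → F.IsFrameFor L → Q ⊆ F.P → (∀ X ∈ Q, X ⊆ S) →
    (subframeOn F S Q).IsGeneral → CofinalSet F S →
    (subframeOn F S Q).IsFrameFor L

/-- the subframe of `F` generated by a point `x` -/
def KFrame.genSub {W : Type} (F : KFrame W) (x : W) :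
    KFrame {y : W // x = y ∨ F.R x y} :=
  ⟨fun a b => F.R a.1 b.1, {S | ∃ X ∈ F.P, S = Subtype.val ⁻¹' X}⟩

namespace KModel

variable {W : Type} (M : KModel W) (x : W) (φ ψ : MF)

theorem sat_or : M.sat x (MF.or φ ψ) ↔ M.sat x φ ∨ M.sat x ψ := by
  simp only [MF.or, sat]; tauto

theorem sat_imp : M.sat x (MF.imp φ ψ) ↔ (M.sat x φ → M.sat x ψ) := by
  simp only [MF.imp, sat_or, sat]; tauto

theorem sat_box : M.sat x (MF.box φ) ↔ ∀ y, M.F.R x y → M.sat y φ := by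
  simp only [MF.box, sat]; push Not; rfl

theorem sat_boxPlus :
    M.sat x (MF.boxPlus φ) ↔ M.sat x φ ∧ ∀ y, M.F.R x y → M.sat y φ := by
  simp only [MF.boxPlus, sat, sat_box]

/-- The truth set of a formula in a model is internal. -/
theorem IsModel.setOf_sat_mem {M : KModel W} (hM : M.IsModel) (φ : MF) :
    {x | M.sat x φ} ∈ M.F.P := by
  obtain ⟨⟨-, hempty, huniv, hinter, hcompl, hdia⟩, hv⟩ := hM
  induction φ with
  | var p => exact hv p
  | top => simpa only [sat, Set.ofPred_true] using huniv
  | bot => simpa only [sat, Set.ofPred_false] using hempty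
  | neg φ ih => exact hcompl _ ih
  | and φ ψ ih₁ ih₂ => exact hinter _ ih₁ _ ih₂
  | dia φ ih =>
    convert hdia _ ih using 1
    ext x
    simp only [sat, KFrame.dia, Set.mem_ofPred_eq]
    exact exists_congr fun y => and_comm

/-- Substitution in a formula amounts to changing the valuation. -/
theorem sat_substVar (s : ℕ → MF) :
    M.sat x (MF.substVar s φ) ↔ (KModel.mk M.F fun p => {y | M.sat y (s p)}).sat x φ := by
  induction φ generalizing x with
  | var p => exact Iff.rfl
  | top => exact Iff.rfl
  | bot => exact Iff.rfl
  | neg φ ih => exact not_congr (ih x)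
  | and φ ψ ih₁ ih₂ => exact and_congr (ih₁ x) (ih₂ x)
  | dia φ ih => exact exists_congr fun y => and_congr_right fun _ => ih y

end KModel

theorem subset_normClosure (Γ : Set MF) : Γ ⊆ NormClosure Γ :=
  fun _ hφ _ _ hL => hL hφ

namespace KFrame

variable {W : Type} {F : KFrame W}

theorem IsGeneral.compl_mem (hg : F.IsGeneral) {X : Set W} (hX : X ∈ F.P) : Xᶜ ∈ F.P :=
  hg.2.2.2.2.1 X hX

theorem IsGeneral.inter_mem (hg : F.IsGeneral) {X Y : Set W} (hX : X ∈ F.P) (hY : Y ∈ F.P) :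
    X ∩ Y ∈ F.P :=
  hg.2.2.2.1 X hX Y hY

theorem IsGeneral.dia_mem (hg : F.IsGeneral) {X : Set W} (hX : X ∈ F.P) : F.dia X ∈ F.P :=
  hg.2.2.2.2.2 X hX

/-- The formulas valid on a general frame form a normal modal logic. -/
theorem IsGeneral.isNormalLogic_setOf_valid (hg : F.IsGeneral) :
    IsNormalLogic {φ | F.Valid φ} where
  taut φ hφ v _ x := hφ (KModel.sat ⟨F, v⟩ x)
    ⟨trivial, id, fun _ => Iff.rfl, fun _ _ => Iff.rfl⟩
  axK v _ x := by
    simp only [KModel.sat_imp, KModel.sat_box]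
    exact fun h h₀ y hy => h y hy (h₀ y hy)
  mp φ ψ hφ hψ v hv x := (KModel.sat_imp _ _ _ _).1 (hψ v hv x) (hφ v hv x)
  subst φ s hφ v hv x := (KModel.sat_substVar _ _ _ _).2 <|
    hφ _ (fun p => KModel.IsModel.setOf_sat_mem (M := ⟨F, v⟩) ⟨hg, hv⟩ (s p)) x
  nec φ hφ v hv x := (KModel.sat_box _ _ _).2 fun y _ => hφ v hv y

theorem IsGeneral.isFrameFor_normClosure_iff (hg : F.IsGeneral) {Γ : Set MF} :
    F.IsFrameFor (NormClosure Γ) ↔ ∀ φ ∈ Γ, F.Valid φ :=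
  ⟨fun h φ hφ => h φ (subset_normClosure Γ hφ),
    fun h _ hφ => hφ _ hg.isNormalLogic_setOf_valid h⟩

/-- Löb's axiom says that every internal set that can be seen from a point is last seen
somewhere. -/
theorem IsGeneral.valid_axGL_iff (hg : F.IsGeneral) :
    F.Valid axGL ↔
      ∀ A ∈ F.P, ∀ x ∈ F.dia A, ∃ y ∈ A, F.R x y ∧ y ∉ F.dia A := by
  simp only [Valid, axGL, KModel.sat_imp, KModel.sat_box, KModel.sat, dia, Set.mem_ofPred_eq]
  constructor
  · rintro h A hA x ⟨z, hzA, hxz⟩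
    by_contra! hcon
    refine h (fun _ => Aᶜ) (fun _ => hg.compl_mem hA) x ?_ z hxz hzA
    intro y hxy hy hyA
    obtain ⟨w, hwA, hyw⟩ := hcon y hyA hxy
    exact hy w hyw hwA
  · intro h v hv x hx y hxy
    by_contra hy
    obtain ⟨z, hz, hxz, hz'⟩ := h _ (hg.compl_mem (hv 0)) x ⟨y, hy, hxy⟩
    refine hz (hx z hxz fun w hzw => ?_)
    by_contra hw
    exact hz' ⟨w, hw, hzw⟩

theorem Descriptive.exists_mem_notMem (hg : F.IsGeneral) (hd : F.Descriptive) {x y : W}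
    (hxy : x ≠ y) : ∃ X ∈ F.P, x ∈ X ∧ y ∉ X := by
  by_contra! hcon
  refine hxy (hd.1 x y fun X hX => ⟨hcon X hX, fun hy => ?_⟩)
  by_contra hx
  exact hcon _ (hg.compl_mem hX) hx hy

theorem Descriptive.exists_mem_notMem_dia (hd : F.Descriptive) {x y : W} (hyx : ¬ F.R y x) :
    ∃ X ∈ F.P, x ∈ X ∧ y ∉ F.dia X := by
  rw [hd.2.1] at hyx
  push Not at hyx
  exact hyx

theorem Descriptive.exists_mem_notMem_notMem_dia (hg : F.IsGeneral) (hd : F.Descriptive)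
    {x y : W} (hxy : x ≠ y) (hyx : ¬ F.R y x) :
    ∃ X ∈ F.P, x ∈ X ∧ y ∉ X ∧ y ∉ F.dia X := by
  obtain ⟨X, hX, hxX, hyX⟩ := hd.exists_mem_notMem hg hxy
  obtain ⟨Y, hY, hxY, hyY⟩ := hd.exists_mem_notMem_dia hyx
  exact ⟨X ∩ Y, hg.inter_mem hX hY, ⟨hxX, hxY⟩, fun h => hyX h.1,
    fun ⟨z, hz, hyz⟩ => hyY ⟨z, hz.2, hyz⟩⟩

theorem Descriptive.trans_of_valid_ax4 (hg : F.IsGeneral) (hd : F.Descriptive)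
    (h4 : F.Valid ax4) {x y z : W} (hxy : F.R x y) (hyz : F.R y z) : F.R x z := by
  by_contra hxz
  obtain ⟨X, hX, hzX, hxX⟩ := hd.exists_mem_notMem_dia hxz
  have h := h4 (fun _ => Xᶜ) (fun _ => hg.compl_mem hX) x
  simp only [ax4, KModel.sat_imp, KModel.sat_box, KModel.sat] at h
  exact h (fun w hxw hwX => hxX ⟨w, hwX, hxw⟩) y hxy z hyz hzX

theorem Descriptive.connected_of_valid_ax43 (hg : F.IsGeneral) (hd : F.Descriptive)
    (h43 : F.Valid ax43) {x y z : W} (hxy : F.R x y) (hxz : F.R x z) :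
    y = z ∨ F.R y z ∨ F.R z y := by
  by_contra! hcon
  obtain ⟨hne, hyz, hzy⟩ := hcon
  obtain ⟨B, hB, hzB, hyB, hyB'⟩ := hd.exists_mem_notMem_notMem_dia hg hne.symm hyz
  obtain ⟨C, hC, hyC, hzC, hzC'⟩ := hd.exists_mem_notMem_notMem_dia hg hne hzy
  have h := h43 (fun p => if p = 0 then Bᶜ else Cᶜ)
    (fun p => by split_ifs; exacts [hg.compl_mem hB, hg.compl_mem hC]) x
  simp only [ax43, KModel.sat_or, KModel.sat_imp, KModel.sat_box, KModel.sat_boxPlus,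
    KModel.sat, if_true, one_ne_zero, if_false] at h
  rcases h with h | h
  · exact h y hxy ⟨hyB, fun w hyw hwB => hyB' ⟨w, hwB, hyw⟩⟩ hyC
  · exact h z hxz ⟨hzC, fun w hzw hwC => hzC' ⟨w, hwC, hzw⟩⟩ hzB

/-- A set is closed if it is an intersection of internal sets. -/
def InternallyClosed (F : KFrame W) (C : Set W) : Prop :=
  ∀ w ∉ C, ∃ U ∈ F.P, C ⊆ U ∧ w ∉ U

theorem internallyClosed_of_mem {C : Set W} (hC : C ∈ F.P) : F.InternallyClosed C :=
  fun _ hw => ⟨C, hC, subset_rfl, hw⟩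

theorem InternallyClosed.inter {C D : Set W} (hC : F.InternallyClosed C)
    (hD : F.InternallyClosed D) : F.InternallyClosed (C ∩ D) := by
  intro w hw
  by_cases hwC : w ∈ C
  · obtain ⟨U, hU, hDU, hwU⟩ := hD w fun hwD => hw ⟨hwC, hwD⟩
    exact ⟨U, hU, Set.inter_subset_right.trans hDU, hwU⟩
  · obtain ⟨U, hU, hCU, hwU⟩ := hC w hwC
    exact ⟨U, hU, Set.inter_subset_left.trans hCU, hwU⟩

theorem Descriptive.internallyClosed_succ (hg : F.IsGeneral) (hd : F.Descriptive) (x : W) :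
    F.InternallyClosed {w | F.R x w} := by
  intro w hw
  obtain ⟨X, hX, hwX, hxX⟩ := hd.exists_mem_notMem_dia hw
  exact ⟨Xᶜ, hg.compl_mem hX, fun z hz hzX => hxX ⟨z, hzX, hz⟩, fun h => h hwX⟩

theorem Descriptive.internallyClosed_eq_or_succ (hg : F.IsGeneral) (hd : F.Descriptive) (x : W) :
    F.InternallyClosed {w | x = w ∨ F.R x w} := by
  intro w hw
  simp only [Set.mem_ofPred_eq, not_or] at hw
  obtain ⟨X, hX, hwX, hxX, hxX'⟩ := hd.exists_mem_notMem_notMem_dia hg (Ne.symm hw.1) hw.2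
  refine ⟨Xᶜ, hg.compl_mem hX, ?_, fun h => h hwX⟩
  rintro z (rfl | hz) hzX
  exacts [hxX hzX, hxX' ⟨z, hzX, hz⟩]

theorem Descriptive.internallyClosed_eq_or_pred (hg : F.IsGeneral) (hd : F.Descriptive) (x : W) :
    F.InternallyClosed {w | w = x ∨ F.R w x} := by
  intro w hw
  simp only [Set.mem_ofPred_eq, not_or] at hw
  obtain ⟨X, hX, hxX, hwX, hwX'⟩ := hd.exists_mem_notMem_notMem_dia hg (Ne.symm hw.1) hw.2
  refine ⟨(Xᶜ ∩ (F.dia X)ᶜ)ᶜ,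
    hg.compl_mem (hg.inter_mem (hg.compl_mem hX) (hg.compl_mem (hg.dia_mem hX))), ?_,
    fun h => h ⟨hwX, hwX'⟩⟩
  rintro z (rfl | hz) ⟨hzX, hzX'⟩
  exacts [hzX hxX, hzX' ⟨x, hxX, hz⟩]

/-- Compactness: a nonempty chain of nonempty closed sets has a common point. -/
theorem Descriptive.nonempty_sInter_of_isChain (hd : F.Descriptive) {𝒞 : Set (Set W)}
    (hne : 𝒞.Nonempty) (hchain : IsChain (· ⊆ ·) 𝒞)
    (h𝒞 : ∀ C ∈ 𝒞, F.InternallyClosed C ∧ C.Nonempty) : (⋂₀ 𝒞).Nonempty := by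
  obtain ⟨w, hw⟩ := hd.2.2 {U | U ∈ F.P ∧ ∃ C ∈ 𝒞, C ⊆ U} (fun U hU => hU.1) <| by
    intro 𝒴 h𝒴 hfin
    suffices h : ∃ C ∈ 𝒞, ∀ U ∈ 𝒴, C ⊆ U by
      obtain ⟨C, hC, hCU⟩ := h
      obtain ⟨w, hw⟩ := (h𝒞 C hC).2
      exact ⟨w, fun U hU => hCU U hU hw⟩
    induction 𝒴, hfin using Set.Finite.induction_on with
    | empty => exact ⟨hne.some, hne.some_mem, by simp⟩
    | @insert V 𝒴 _ _ ih =>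
      obtain ⟨C, hC, hCU⟩ := ih ((Set.subset_insert _ _).trans h𝒴)
      obtain ⟨-, D, hD, hDV⟩ := h𝒴 (Set.mem_insert V 𝒴)
      rcases hchain.total hC hD with hCD | hDC
      · exact ⟨C, hC, Set.forall_mem_insert.2 ⟨hCD.trans hDV, hCU⟩⟩
      · exact ⟨D, hD, Set.forall_mem_insert.2 ⟨hDV, fun U hU => hDC.trans (hCU U hU)⟩⟩
  refine ⟨w, fun C hC => ?_⟩
  by_contra hwC
  obtain ⟨U, hU, hCU, hwU⟩ := (h𝒞 C hC).1 w hwC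
  exact hwU (hw U ⟨hU, C, hC, hCU⟩)

/-- In a linear descriptive frame, an internal set seen from `x` has a maximal point seen
from `x`. -/
theorem Descriptive.exists_maximal (hg : F.IsGeneral) (hd : F.Descriptive)
    (htrans : ∀ x y z, F.R x y → F.R y z → F.R x z)
    (hconn : ∀ y z, y = z ∨ F.R y z ∨ F.R z y) {A : Set W} (hA : A ∈ F.P) {x : W}
    (hx : x ∈ F.dia A) : ∃ y ∈ A, F.R x y ∧ ∀ z ∈ A, F.R y z → F.R z y := by
  obtain ⟨a, haA, hxa⟩ := hx
  let upper (z : W) : Set W := A ∩ {w | z = w ∨ F.R z w}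
  have hupper : ∀ y z, F.R y z → upper z ⊆ upper y := by
    rintro y z hyz w ⟨hwA, rfl | hzw⟩
    exacts [⟨hwA, .inr hyz⟩, ⟨hwA, .inr (htrans _ _ _ hyz hzw)⟩]
  obtain ⟨w, hw⟩ := hd.nonempty_sInter_of_isChain (𝒞 := upper '' {z ∈ A | F.R x z})
    ⟨_, a, ⟨haA, hxa⟩, rfl⟩
    (by
      rintro _ ⟨y, -, rfl⟩ _ ⟨z, -, rfl⟩ -
      rcases hconn y z with rfl | h | h
      exacts [.inl subset_rfl, .inr (hupper _ _ h), .inl (hupper _ _ h)])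
    (by
      rintro _ ⟨z, hz, rfl⟩
      exact ⟨(internallyClosed_of_mem hA).inter (hd.internallyClosed_eq_or_succ hg z),
        z, hz.1, .inl rfl⟩)
  have hmax : ∀ z ∈ A, F.R x z → w ∈ upper z := fun z hzA hxz => hw _ ⟨z, ⟨hzA, hxz⟩, rfl⟩
  have hxw : F.R x w := by
    rcases (hmax a haA hxa).2 with rfl | h
    exacts [hxa, htrans _ _ _ hxa h]
  refine ⟨w, (hmax a haA hxa).1, hxw, fun z hzA hwz => ?_⟩
  rcases (hmax z hzA (htrans _ _ _ hxw hwz)).2 with rfl | h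
  exacts [hwz, h]

/-- In a linear descriptive frame, a non-final cluster whose strict successors form a closed
set has an immediate successor. -/
theorem Descriptive.exists_immSucc (hg : F.IsGeneral) (hd : F.Descriptive)
    (htrans : ∀ x y z, F.R x y → F.R y z → F.R x z)
    (hconn : ∀ y z, y = z ∨ F.R y z ∨ F.R z y) {y : W}
    (hclosed : F.InternallyClosed {z | F.clLT y z}) (hy : ¬ F.FinalCl y) :
    ∃ z, F.ImmSucc y z := by
  simp only [FinalCl, not_forall, not_not] at hy
  obtain ⟨a, ha⟩ := hy
  let lower (z : W) : Set W := {w | F.clLT y w} ∩ {w | w = z ∨ F.R w z}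
  have hlower : ∀ u z, F.R u z → lower u ⊆ lower z := by
    rintro u z huz w ⟨hyw, rfl | hwu⟩
    exacts [⟨hyw, .inr huz⟩, ⟨hyw, .inr (htrans _ _ _ hwu huz)⟩]
  obtain ⟨w, hw⟩ := hd.nonempty_sInter_of_isChain (𝒞 := lower '' {z | F.clLT y z})
    ⟨_, a, ha, rfl⟩
    (by
      rintro _ ⟨u, -, rfl⟩ _ ⟨z, -, rfl⟩ -
      rcases hconn u z with rfl | h | h
      exacts [.inl subset_rfl, .inl (hlower _ _ h), .inr (hlower _ _ h)])
    (by
      rintro _ ⟨z, hz, rfl⟩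
      exact ⟨hclosed.inter (hd.internallyClosed_eq_or_pred hg z), z, hz, .inl rfl⟩)
  refine ⟨w, (hw _ ⟨a, ha, rfl⟩).1, ?_⟩
  rintro ⟨z, hyz, hzw⟩
  rcases (hw _ ⟨z, hyz, rfl⟩).2 with rfl | h
  exacts [hzw.2 hzw.1, hzw.2 h]

/-- In a linear descriptive frame, a cluster containing a maximal point of an internal set is
not a limit cluster. -/
theorem Descriptive.not_limitCl_of_maximal (hg : F.IsGeneral) (hd : F.Descriptive)
    (htrans : ∀ x y z, F.R x y → F.R y z → F.R x z)
    (hconn : ∀ y z, y = z ∨ F.R y z ∨ F.R z y) {A : Set W} (hA : A ∈ F.P) {y : W}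
    (hyA : y ∈ A) (hmax : ∀ z ∈ A, F.R y z → F.R z y) : ¬ F.LimitCl y := by
  rintro ⟨hfinal, hsucc⟩
  refine hsucc (hd.exists_immSucc hg htrans hconn ?_ hfinal)
  have heq : {z | F.clLT y z} = {z | F.R y z} ∩ (Aᶜ ∩ (F.dia A)ᶜ) := by
    ext z
    refine and_congr_right fun hyz => ⟨fun hzy => ⟨fun hzA => hzy (hmax z hzA hyz), ?_⟩,
      fun hz hzy => hz.2 ⟨y, hyA, hzy⟩⟩
    rintro ⟨w, hwA, hzw⟩
    exact hzy (htrans _ _ _ hzw (hmax w hwA (htrans _ _ _ hyz hzw)))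
  rw [heq]
  exact (hd.internallyClosed_succ hg y).inter
    (internallyClosed_of_mem (hg.inter_mem (hg.compl_mem hA) (hg.compl_mem (hg.dia_mem hA))))

/-- In a linear descriptive frame, every non-limit cluster contains a maximal point of an
internal set. -/
theorem Descriptive.exists_maximal_of_not_limitCl (hg : F.IsGeneral) (hd : F.Descriptive)
    (hconn : ∀ y z, y = z ∨ F.R y z ∨ F.R z y) {x : W} (hx : ¬ F.LimitCl x) :
    ∃ A ∈ F.P, x ∈ A ∧ ∀ z ∈ A, F.R x z → F.R z x := by
  by_cases hfinal : F.FinalCl x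
  · refine ⟨Set.univ, hg.2.2.1, trivial, fun z _ hxz => ?_⟩
    by_contra hzx
    exact hfinal z ⟨hxz, hzx⟩
  · obtain ⟨y, ⟨hxy, hyx⟩, himm⟩ := not_not.1 fun h => hx ⟨hfinal, h⟩
    obtain ⟨A, hA, hxA, hyA, hyA'⟩ := hd.exists_mem_notMem_notMem_dia hg
      (by rintro rfl; exact hyx hxy) hyx
    refine ⟨A, hA, hxA, fun z hzA hxz => ?_⟩
    have hyz : ¬ F.R y z := fun h => hyA' ⟨z, hzA, h⟩
    by_contra hzx
    rcases hconn z y with rfl | h | h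
    exacts [hyA hzA, himm ⟨z, ⟨hxz, hzx⟩, h, hyz⟩, hyz h]

end KFrame

/-- a rooted finitely generated descriptive frame for `K4.3` is a frame for
`GL.3` iff every non-degenerate cluster of it is a limit cluster (Example `e:canform (a)`). -/
theorem gl3_frame_characterisation (W : Type) (F : KFrame W) (hg : F.IsGeneral)
    (hroot : ∃ r, F.Rooted r) (hfg : F.FinGenerated) (hd : F.Descriptive)
    (hK : F.IsFrameFor K43) :
    F.IsFrameFor GL3 ↔ ∀ x : W, F.R x x → F.LimitCl x := by
  have h43 := hg.isFrameFor_normClosure_iff.1 hK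
  have h4 : F.Valid ax4 := h43 _ (by simp)
  have hl : F.Valid ax43 := h43 _ (by simp)
  have htrans : ∀ x y z, F.R x y → F.R y z → F.R x z := fun _ _ _ =>
    hd.trans_of_valid_ax4 hg h4
  have hconn : ∀ y z, y = z ∨ F.R y z ∨ F.R z y := by
    obtain ⟨r, hr⟩ := hroot
    intro y z
    rcases hr y with rfl | hy
    · exact (hr z).imp_right .inl
    rcases hr z with rfl | hz
    · exact .inr (.inr hy)
    · exact hd.connected_of_valid_ax43 hg hl hy hz
  have hGL : F.IsFrameFor GL3 ↔ F.Valid axGL := by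
    simp [GL3, hg.isFrameFor_normClosure_iff, h4, hl]
  rw [hGL, hg.valid_axGL_iff]
  constructor
  · intro h x hxx
    by_contra hx
    obtain ⟨A, hA, hxA, hmax⟩ := hd.exists_maximal_of_not_limitCl hg hconn hx
    obtain ⟨y, hyA, hxy, hy⟩ := h A hA x ⟨x, hxA, hxx⟩
    exact hy ⟨x, hxA, hmax y hyA hxy⟩
  · intro h A hA x hx
    obtain ⟨y, hyA, hxy, hmax⟩ := hd.exists_maximal hg htrans hconn hA hx
    refine ⟨y, hyA, hxy, ?_⟩
    rintro ⟨z, hzA, hyz⟩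
    have hyy : F.R y y := htrans _ _ _ hyz (hmax z hzA hyz)
    exact hd.not_limitCl_of_maximal hg htrans hconn hA hyA hmax (h y hyy)
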